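/- arXiv:1806.11087 — 3 statements merged into one kernel-verified Lean document; each statement's English description precedes it below -/
import Mathlib

section
/- Let E be a directed graph. Every tail-equivalence class of boundary paths of E contains at least 3 elements if and only if E has no degenerate vertices. -/
/-! ## Directed graphs, paths, and the boundary path space -/

/-- A directed graph: edge set `E`, vertex set `V`, source and range maps. -/
structure DGraph (V : Type*) (E : Type*) where
  s : E → V
  r : E → V

variable {V E : Type*}

/-- A finite path in a directed graph: a base (source) vertex together with a finite
sequence of composable edges; vertices are the trivial paths. -/
structure FinPath (G : DGraph V E) where
  src : V
  edges : List E
  src_eq : ∀ e ∈ edges.head?, G.s e = src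
  chain : edges.Chain' fun e f => G.r e = G.s f

namespace FinPath

variable {G : DGraph V E}

/-- The range (terminal vertex) of a finite path. -/
def rng (μ : FinPath G) : V := μ.edges.getLast?.elim μ.src G.r

/-- `μ ≤ ν`: `ν` extends `μ`, i.e. `ν = μλ` for some (possibly trivial) path `λ`. -/
def Le (μ ν : FinPath G) : Prop := μ.src = ν.src ∧ μ.edges <+: ν.edges

/-- Two finite paths are disjoint if neither is an initial segment of the other. -/
def Disjoint (μ ν : FinPath G) : Prop := ¬ Le μ ν ∧ ¬ Le ν μ

/-- A cycle: a nontrivial path returning to its base vertex. -/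
def IsCycle (μ : FinPath G) : Prop := μ.edges ≠ [] ∧ μ.rng = μ.src

/-- A return path: a cycle not passing through its base vertex in between. -/
def IsReturnPath (μ : FinPath G) : Prop :=
  IsCycle μ ∧ ∀ (i : ℕ) (h : i + 1 < μ.edges.length),
    G.r (μ.edges.get ⟨i, Nat.lt_of_succ_lt h⟩) ≠ μ.rng

/-- A path has an exit. -/
def HasExit (μ : FinPath G) : Prop :=
  ∃ (i : Fin μ.edges.length) (e : E),
    G.s e = G.s (μ.edges.get i) ∧ e ≠ μ.edges.get i

end FinPath

/-- The trivial path at a vertex. -/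
def trivialPath (G : DGraph V E) (v : V) : FinPath G :=
  ⟨v, [], by intro e he; simp at he, List.IsChain.nil⟩

/-- An infinite path in a directed graph. -/
structure InfPath (G : DGraph V E) where
  edges : ℕ → E
  chain : ∀ i, G.r (edges i) = G.s (edges (i + 1))

/-- The source vertex of an infinite path. -/
def InfPath.src {G : DGraph V E} (x : InfPath G) : V := G.s (x.edges 0)

/-- A wandering infinite path: it visits each vertex only finitely often. -/
def Wandering {G : DGraph V E} (x : InfPath G) : Prop :=
  ∀ v : V, {i : ℕ | G.s (x.edges i) = v}.Finite

/-- A semi-tail: a wandering infinite path each of whose edges is the unique edge emitted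
by its source. -/
def IsSemiTail {G : DGraph V E} (x : InfPath G) : Prop :=
  Wandering x ∧ ∀ i, ∀ e : E, G.s e = G.s (x.edges i) → e = x.edges i

/-- A sink: a vertex emitting no edges. -/
def IsSink (G : DGraph V E) (v : V) : Prop := ∀ e : E, G.s e ≠ v

/-- An infinite emitter. -/
def InfEmitter (G : DGraph V E) (v : V) : Prop := {e : E | G.s e = v}.Infinite

/-- A singular vertex: a sink or an infinite emitter. -/
def Singular (G : DGraph V E) (v : V) : Prop := IsSink G v ∨ InfEmitter G v

/-- `v ≥ w`: there is a finite path from `v` to `w`. -/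
def Reaches (G : DGraph V E) (v w : V) : Prop :=
  ∃ μ : FinPath G, μ.src = v ∧ μ.rng = w

/-- Condition (L): every cycle has an exit. -/
def CondL (G : DGraph V E) : Prop :=
  ∀ μ : FinPath G, μ.IsCycle → μ.HasExit

/-- Condition (T): from every vertex there are at least two distinct paths to some common
vertex. -/
def CondT (G : DGraph V E) : Prop :=
  ∀ v : V, ∃ μ ν : FinPath G, μ ≠ ν ∧ μ.src = v ∧ ν.src = v ∧ μ.rng = ν.rng

/-- Condition (K): every vertex supports either no return path or at least two. -/
def CondK (G : DGraph V E) : Prop :=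
  ∀ v : V, (¬ ∃ μ : FinPath G, μ.IsReturnPath ∧ μ.src = v) ∨
    (∃ μ ν : FinPath G, μ ≠ ν ∧ μ.IsReturnPath ∧ ν.IsReturnPath ∧ μ.src = v ∧ ν.src = v)

/-- Condition (W): every wandering infinite path admits a second route from its source to
the range of one of its edges. -/
def CondW (G : DGraph V E) : Prop :=
  ∀ x : InfPath G, Wandering x →
    ∃ (n : ℕ) (μ ν : FinPath G), μ ≠ ν ∧ μ.src = x.src ∧ ν.src = x.src ∧
      μ.rng = G.r (x.edges n) ∧ ν.rng = G.r (x.edges n)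

/-- Condition (∞): every infinite emitter emits infinitely many edges whose ranges can
reach back. -/
def CondInf (G : DGraph V E) : Prop :=
  ∀ v : V, InfEmitter G v → {e : E | G.s e = v ∧ Reaches G (G.r e) v}.Infinite

/-- Cofinality: every vertex can reach some vertex on every infinite path. -/
def Cofinal (G : DGraph V E) : Prop :=
  ∀ (v : V) (x : InfPath G), ∃ n : ℕ, Reaches G v (G.s (x.edges n))

/-- The boundary path space: all infinite paths together with all finite paths ending at a
singular vertex. -/
def BPath (G : DGraph V E) : Type _ :=
  {μ : FinPath G // Singular G μ.rng} ⊕ InfPath G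

namespace BPath

variable {G : DGraph V E}

/-- The source vertex of a boundary path. -/
def src : BPath G → V
  | Sum.inl p => p.1.src
  | Sum.inr x => x.src

/-- The `n`-th edge of a boundary path (0-indexed), if it exists. -/
def edgeAt : BPath G → ℕ → Option E
  | Sum.inl p, n => p.1.edges[n]?
  | Sum.inr x, n => some (x.edges n)

end BPath

/-- A finite path `μ` is an initial segment of a boundary path `p`. -/
def IsPrefixOf {G : DGraph V E} (μ : FinPath G) (p : BPath G) : Prop :=
  μ.src = p.src ∧ ∀ i, i < μ.edges.length → p.edgeAt i = μ.edges[i]?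

/-- The cylinder set `Z(μ)` of a finite path. -/
def ZSet {G : DGraph V E} (μ : FinPath G) : Set (BPath G) :=
  {p | IsPrefixOf μ p}

/-- The basic set `Z(μ∖F) = Z(μ) ∖ ⋃_{e ∈ F} Z(μe)`. -/
def ZMinus {G : DGraph V E} (μ : FinPath G) (F : Set E) : Set (BPath G) :=
  {p | IsPrefixOf μ p ∧ ∀ e ∈ F, p.edgeAt μ.edges.length ≠ some e}

/-- The topology on the boundary path space generated by the basic sets `Z(μ∖F)`. -/
instance bpathTopology {G : DGraph V E} : TopologicalSpace (BPath G) :=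
  TopologicalSpace.generateFrom
    {S | ∃ (μ : FinPath G) (F : Set E), F.Finite ∧ (∀ e ∈ F, G.s e = μ.rng) ∧ S = ZMinus μ F}

/-- Tail equivalence of boundary paths. -/
def TailEquiv {G : DGraph V E} : BPath G → BPath G → Prop
  | Sum.inl p, Sum.inl q => p.1.rng = q.1.rng
  | Sum.inr x, Sum.inr y => ∃ k l : ℕ, ∀ n : ℕ, x.edges (k + n) = y.edges (l + n)
  | Sum.inl _, Sum.inr _ => False
  | Sum.inr _, Sum.inl _ => False

/-- The set of edges received by a vertex. -/
def recvSet (G : DGraph V E) (v : V) : Set E := {e | G.r e = v}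

/-- The set of edges emitted by a vertex. -/
def emitSet (G : DGraph V E) (v : V) : Set E := {e | G.s e = v}

/-- A degenerate vertex (six types). -/
def Degenerate (G : DGraph V E) (v : V) : Prop :=
  (∃ e : E, recvSet G v = {e} ∧ G.s e = v) ∨
  (∃ e f : E, e ≠ f ∧ recvSet G v = {e, f} ∧ G.s e = v ∧ recvSet G (G.s f) = ∅) ∨
  (∃ w : V, w ≠ v ∧ (∃ e : E, recvSet G v = {e} ∧ G.s e = w) ∧
    (∃ f : E, recvSet G w = {f} ∧ G.s f = v)) ∨
  (InfEmitter G v ∧ recvSet G v = ∅) ∨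
  (Singular G v ∧ ∃ f : E, recvSet G v = {f} ∧ recvSet G (G.s f) = ∅) ∨
  (emitSet G v = ∅ ∧ recvSet G v = ∅)

theorem FinPath.eq_of {G : DGraph V E} {μ ν : FinPath G} (h1 : μ.src = ν.src)
    (h2 : μ.edges = ν.edges) : μ = ν := by
  cases μ; cases ν; simp only at h1 h2; subst h1; subst h2; rfl

theorem InfPath.eq_of {G : DGraph V E} {x y : InfPath G} (h : ∀ n, x.edges n = y.edges n) :
    x = y := by
  cases x; cases y; have := funext h; simp only at this; subst this; rfl

/-- prepend an edge -/
def InfPath.cons {G : DGraph V E} (g : E) (y : InfPath G) (h : G.r g = G.s (y.edges 0)) :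
    InfPath G where
  edges := fun n => match n with
    | 0 => g
    | n + 1 => y.edges n
  chain := by
    intro i
    cases i with
    | zero => exact h
    | succ n => exact y.chain n

/-- shift an infinite path -/
def InfPath.shift {G : DGraph V E} (k : ℕ) (y : InfPath G) : InfPath G where
  edges := fun n => y.edges (k + n)
  chain := fun i => y.chain (k + i)

theorem pick_three {G : DGraph V E} (p a b c : BPath G) (ha : TailEquiv p a)
    (hb : TailEquiv p b) (hc : TailEquiv p c) (hab : a ≠ b) (hac : a ≠ c) (hbc : b ≠ c) :
    ∃ q r : BPath G, TailEquiv p q ∧ TailEquiv p r ∧ p ≠ q ∧ p ≠ r ∧ q ≠ r := by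
  by_cases h1 : p = a
  · subst h1; exact ⟨b, c, hb, hc, hab, hac, hbc⟩
  by_cases h2 : p = b
  · subst h2; exact ⟨a, c, ha, hc, h1, hbc, hac⟩
  · exact ⟨a, b, ha, hb, h1, h2, hab⟩

theorem pick_three_inf {G : DGraph V E} (p a b c : InfPath G)
    (ha : ∃ k l : ℕ, ∀ n : ℕ, p.edges (k + n) = a.edges (l + n))
    (hb : ∃ k l : ℕ, ∀ n : ℕ, p.edges (k + n) = b.edges (l + n))
    (hc : ∃ k l : ℕ, ∀ n : ℕ, p.edges (k + n) = c.edges (l + n))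
    (hab : a ≠ b) (hac : a ≠ c) (hbc : b ≠ c) :
    ∃ q r : BPath G, TailEquiv (Sum.inr p) q ∧ TailEquiv (Sum.inr p) r ∧ (Sum.inr p : BPath G) ≠ q
      ∧ (Sum.inr p : BPath G) ≠ r ∧ q ≠ r :=
  pick_three (Sum.inr p) (Sum.inr a) (Sum.inr b) (Sum.inr c) ha hb hc
    (fun h => hab (Sum.inr_injective h)) (fun h => hac (Sum.inr_injective h))
    (fun h => hbc (Sum.inr_injective h))

/-- Case of a finite boundary path. -/
theorem fin_case {G : DGraph V E} (H : ∀ v : V, ¬ Degenerate G v)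
    (p : {μ : FinPath G // Singular G μ.rng}) :
    ∃ q r : BPath G, TailEquiv (Sum.inl p) q ∧ TailEquiv (Sum.inl p) r ∧
      (Sum.inl p : BPath G) ≠ q ∧ (Sum.inl p : BPath G) ≠ r ∧ q ≠ r := by
  obtain ⟨μ, hs⟩ := p
  obtain ⟨v, hv⟩ : ∃ v, v = μ.rng := ⟨_, rfl⟩
  have hs' : Singular G v := hv ▸ hs
  have key : ∀ a b c : FinPath G, a.rng = v → b.rng = v → c.rng = v →
      a.edges ≠ b.edges → a.edges ≠ c.edges → b.edges ≠ c.edges →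
      ∃ q r : BPath G, TailEquiv (Sum.inl ⟨μ, hs⟩) q ∧ TailEquiv (Sum.inl ⟨μ, hs⟩) r ∧
      (Sum.inl ⟨μ, hs⟩ : BPath G) ≠ q ∧ (Sum.inl ⟨μ, hs⟩ : BPath G) ≠ r ∧ q ≠ r := by
    intro a b c ha hb hc hab hac hbc
    refine pick_three _ (Sum.inl ⟨a, ha ▸ hs'⟩) (Sum.inl ⟨b, hb ▸ hs'⟩) (Sum.inl ⟨c, hc ▸ hs'⟩)
      ?_ ?_ ?_ ?_ ?_ ?_
    · exact (hv.symm.trans ha.symm : μ.rng = a.rng)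
    · exact (hv.symm.trans hb.symm : μ.rng = b.rng)
    · exact (hv.symm.trans hc.symm : μ.rng = c.rng)
    · intro h
      have := Sum.inl_injective h
      exact hab (congrArg (fun z : {μ : FinPath G // Singular G μ.rng} => z.1.edges) this)
    · intro h
      have := Sum.inl_injective h
      exact hac (congrArg (fun z : {μ : FinPath G // Singular G μ.rng} => z.1.edges) this)
    · intro h
      have := Sum.inl_injective h
      exact hbc (congrArg (fun z : {μ : FinPath G // Singular G μ.rng} => z.1.edges) this)
  have hd := H v
  let P1 : E → FinPath G := fun e => ⟨G.s e, [e], by simp, List.IsChain.singleton _⟩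
  have hne : ∃ f, G.r f = v := by
    by_contra hc
    push Not at hc
    have hr : recvSet G v = ∅ := Set.eq_empty_of_forall_notMem hc
    rcases hs' with h | h
    · exact hd (Or.inr (Or.inr (Or.inr (Or.inr (Or.inr
        ⟨Set.eq_empty_of_forall_notMem h, hr⟩)))))
    · exact hd (Or.inr (Or.inr (Or.inr (Or.inl ⟨h, hr⟩))))
  obtain ⟨f, hf⟩ := hne
  by_cases h2 : ∃ g, G.r g = v ∧ g ≠ f
  · obtain ⟨g, hg, hgf⟩ := h2
    exact key (trivialPath G v) (P1 f) (P1 g) rfl hf hg (by simp [trivialPath, P1])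
      (by simp [trivialPath, P1]) (by simp [P1, hgf.symm])
  · push Not at h2
    have hr : recvSet G v = {f} := by
      ext g
      exact ⟨fun h => h2 g h, fun h => by rw [Set.mem_singleton_iff.1 h]; exact hf⟩
    by_cases h3 : ∃ g, G.r g = G.s f
    · obtain ⟨g, hg⟩ := h3
      exact key (trivialPath G v) (P1 f) ⟨G.s g, [g, f], by simp, by
        change List.IsChain _ _; simp [hg]⟩ rfl hf hf
        (by simp [trivialPath, P1]) (by simp [trivialPath]) (by simp [P1])
    · push Not at h3
      exact absurd (Or.inr (Or.inr (Or.inr (Or.inr (Or.inl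
        ⟨hs', f, hr, Set.eq_empty_of_forall_notMem h3⟩))))) hd

/-- Case of an infinite path. -/
theorem inf_case {G : DGraph V E} (H : ∀ v : V, ¬ Degenerate G v) (p : InfPath G) :
    ∃ q r : BPath G, TailEquiv (Sum.inr p) q ∧ TailEquiv (Sum.inr p) r ∧
      (Sum.inr p : BPath G) ≠ q ∧ (Sum.inr p : BPath G) ≠ r ∧ q ≠ r := by
  have tail0 : ∀ i, ∃ k l : ℕ, ∀ n, p.edges (k + n) = (p.shift i).edges (l + n) :=
    fun i => ⟨i, 0, fun n => by simp [InfPath.shift]⟩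
  -- prepending stays in the class
  have tcons : ∀ (y : InfPath G) g h,
      (∃ k l : ℕ, ∀ n, p.edges (k + n) = y.edges (l + n)) →
      ∃ k l : ℕ, ∀ n, p.edges (k + n) = (y.cons g h).edges (l + n) := by
    rintro y g h ⟨k, l, hkl⟩
    refine ⟨k, l + 1, fun n => ?_⟩
    rw [hkl, show l + 1 + n = (l + n) + 1 by omega]
    rfl
  have hfix : ∀ y : InfPath G, (∃ k l : ℕ, ∀ n, p.edges (k + n) = y.edges (l + n)) →
      (∀ n, y.edges (n + 1) = y.edges n) →
      ∃ q r : BPath G, TailEquiv (Sum.inr p) q ∧ TailEquiv (Sum.inr p) r ∧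
      (Sum.inr p : BPath G) ≠ q ∧ (Sum.inr p : BPath G) ≠ r ∧ q ≠ r := by
    intro y hy hper
    obtain ⟨e, he⟩ : ∃ e, e = y.edges 0 := ⟨_, rfl⟩
    have h1 : y.edges 1 = e := by rw [he]; exact hper 0
    have hloop : G.r e = G.s e := by
      have := y.chain 0
      rwa [zero_add, h1, ← he] at this
    have hd := H (G.s e)
    have hf : ∃ f, G.r f = G.s e ∧ f ≠ e := by
      by_contra hc
      push Not at hc
      refine hd (Or.inl ⟨e, ?_, rfl⟩)
      ext g
      exact ⟨fun h => hc g h, fun h => by rw [Set.mem_singleton_iff.1 h]; exact hloop⟩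
    obtain ⟨f, hf, hfe⟩ := hf
    have hf' : G.r f = G.s (y.edges 0) := by rw [← he]; exact hf
    have n1 : y ≠ y.cons f hf' := by
      intro h
      have := congrArg (fun z : InfPath G => z.edges 0) h
      exact hfe (this.symm.trans he.symm)
    by_cases h3 : ∃ g, G.r g = G.s f
    · obtain ⟨g, hg⟩ := h3
      refine pick_three_inf p y (y.cons f hf') ((y.cons f hf').cons g hg) hy (tcons _ _ _ hy)
        (tcons _ _ _ (tcons _ _ _ hy)) n1 ?_ ?_
      · intro h
        have := congrArg (fun z : InfPath G => z.edges 1) h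
        exact hfe (this.symm.trans h1)
      · intro h
        have := congrArg (fun z : InfPath G => z.edges 1) h
        exact hfe (this.symm.trans he.symm)
    · push Not at h3
      have hh : ∃ h, G.r h = G.s e ∧ h ≠ e ∧ h ≠ f := by
        by_contra hc
        push Not at hc
        refine hd (Or.inr (Or.inl ⟨e, f, hfe.symm, ?_, rfl, Set.eq_empty_of_forall_notMem h3⟩))
        ext g
        constructor
        · intro h
          by_cases hge : g = e
          · exact Or.inl hge
          · exact Or.inr (hc g h hge)
        · rintro (h | h)
          · rw [h]; exact hloop
          · rw [Set.mem_singleton_iff.1 h]; exact hf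
      obtain ⟨h, hh, hhe, hhf⟩ := hh
      refine pick_three_inf p y (y.cons f hf') (y.cons h (by rw [← he]; exact hh)) hy
        (tcons _ _ _ hy) (tcons _ _ _ hy) n1 ?_ ?_
      · intro hq
        have := congrArg (fun z : InfPath G => z.edges 0) hq
        exact hhe (this.symm.trans he.symm)
      · intro hq
        have := congrArg (fun z : InfPath G => z.edges 0) hq
        exact hhf this.symm
  have shift_succ : ∀ i, p.shift i = p.shift (i + 1) → ∀ n,
      (p.shift i).edges (n + 1) = (p.shift i).edges n := by
    intro i h n
    have := congrArg (fun z : InfPath G => z.edges n) h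
    simp only [InfPath.shift] at this ⊢
    rw [this]; congr 1; omega
  by_cases h01 : p.shift 0 = p.shift 1
  · exact hfix _ (tail0 0) (shift_succ 0 h01)
  by_cases h12 : p.shift 1 = p.shift 2
  · exact hfix _ (tail0 1) (shift_succ 1 h12)
  by_cases h02 : p.shift 0 = p.shift 2
  swap
  · exact pick_three_inf p _ _ _ (tail0 0) (tail0 1) (tail0 2) h01 h02 h12
  -- period exactly two
  have per : ∀ n, p.edges (n + 2) = p.edges n := by
    intro n
    have := congrArg (fun z : InfPath G => z.edges n) h02
    simp only [InfPath.shift, zero_add] at this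
    rw [this, add_comm]
  have c0 : G.r (p.edges 0) = G.s (p.edges 1) := p.chain 0
  have c1 : G.r (p.edges 1) = G.s (p.edges 0) := by
    have := p.chain 1
    rwa [show 1 + 1 = 0 + 2 from rfl, per 0] at this
  by_cases hg : ∃ g, G.r g = G.s (p.edges 0) ∧ g ≠ p.edges 1
  · obtain ⟨g, hg, hg1⟩ := hg
    refine pick_three_inf p (p.shift 0) (p.shift 1) ((p.shift 0).cons g hg) (tail0 0) (tail0 1)
      (tcons _ _ _ (tail0 0)) h01 ?_ ?_
    · intro h
      apply h01
      apply InfPath.eq_of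
      intro n
      have := congrArg (fun z : InfPath G => z.edges (n + 1)) h
      have h' : (p.shift 0).edges (n + 1) = (p.shift 0).edges n := this
      rw [← h']
      simp only [InfPath.shift]; congr 1; omega
    · intro h
      have := congrArg (fun z : InfPath G => z.edges 0) h
      exact hg1 this.symm
  by_cases hk : ∃ g, G.r g = G.s (p.edges 1) ∧ g ≠ p.edges 0
  · obtain ⟨g, hk, hk1⟩ := hk
    refine pick_three_inf p (p.shift 1) (p.shift 2) ((p.shift 1).cons g hk) (tail0 1) (tail0 2)
      (tcons _ _ _ (tail0 1)) h12 ?_ ?_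
    · intro h
      apply h12
      apply InfPath.eq_of
      intro n
      have := congrArg (fun z : InfPath G => z.edges (n + 1)) h
      have h' : (p.shift 1).edges (n + 1) = (p.shift 1).edges n := this
      rw [← h']
      simp only [InfPath.shift]; congr 1; omega
    · intro h
      have := congrArg (fun z : InfPath G => z.edges 0) h
      exact hk1 (this.symm.trans (per 0))
  push Not at hg hk
  exfalso
  by_cases hvw : G.s (p.edges 1) = G.s (p.edges 0)
  · have e1 := hg (p.edges 0) (c0.trans hvw)
    apply h01
    apply InfPath.eq_of
    intro n
    have : ∀ n, p.edges n = p.edges 0 := by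
      intro n
      induction n using Nat.twoStepInduction with
      | zero => rfl
      | one => exact e1.symm
      | more n ih _ => rw [per]; exact ih
    simp only [InfPath.shift]
    rw [this, this (1 + n)]
  · refine H (G.s (p.edges 0)) (Or.inr (Or.inr (Or.inl ⟨G.s (p.edges 1), hvw,
      ⟨p.edges 1, ?_, rfl⟩, ⟨p.edges 0, ?_, rfl⟩⟩)))
    · ext g
      exact ⟨fun h => hg g h, fun h => by rw [Set.mem_singleton_iff.1 h]; exact c1⟩
    · ext g
      exact ⟨fun h => hk g h, fun h => by rw [Set.mem_singleton_iff.1 h]; exact c0⟩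

/-- An infinite path class determined by the head, with two possible heads, is too small. -/
theorem small_inf {G : DGraph V E} (p : InfPath G) (e f : E)
    (h0 : ∀ q : InfPath G, (∃ k l : ℕ, ∀ n, p.edges (k + n) = q.edges (l + n)) →
      q.edges 0 = e ∨ q.edges 0 = f)
    (h1 : ∀ q r : InfPath G, (∃ k l : ℕ, ∀ n, p.edges (k + n) = q.edges (l + n)) →
      (∃ k l : ℕ, ∀ n, p.edges (k + n) = r.edges (l + n)) →
      q.edges 0 = r.edges 0 → q = r)
    (H : ∀ p : BPath G, ∃ q r : BPath G,
      TailEquiv p q ∧ TailEquiv p r ∧ p ≠ q ∧ p ≠ r ∧ q ≠ r) : False := by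
  obtain ⟨q, r, hq, hr, hpq, hpr, hqr⟩ := H (Sum.inr p)
  rcases q with q | q
  · exact hq
  rcases r with r | r
  · exact hr
  have hp : ∃ k l : ℕ, ∀ n, p.edges (k + n) = p.edges (l + n) := ⟨0, 0, fun _ => rfl⟩
  have a1 : p.edges 0 ≠ q.edges 0 := fun h => hpq (congrArg Sum.inr (h1 p q hp hq h))
  have a2 : p.edges 0 ≠ r.edges 0 := fun h => hpr (congrArg Sum.inr (h1 p r hp hr h))
  have a3 : q.edges 0 ≠ r.edges 0 := fun h => hqr (congrArg Sum.inr (h1 q r hq hr h))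
  have b1 := h0 p hp
  have b2 := h0 q hq
  have b3 := h0 r hr
  grind

theorem small_fin {G : DGraph V E} (v : V) (hs : Singular G v) (f : E)
    (h0 : ∀ q : FinPath G, q.rng = v → q.edges = [] ∨ q.edges = [f])
    (H : ∀ p : BPath G, ∃ q r : BPath G,
      TailEquiv p q ∧ TailEquiv p r ∧ p ≠ q ∧ p ≠ r ∧ q ≠ r) : False := by
  have h1 : ∀ q r : FinPath G, q.rng = v → r.rng = v → q.edges = r.edges → q = r := by
    intro q r hq hr h
    refine FinPath.eq_of ?_ h
    rcases h0 q hq with h2 | h2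
    · have h3 := h ▸ h2
      simp only [FinPath.rng, h2] at hq
      simp only [FinPath.rng, h3] at hr
      exact hq.trans hr.symm
    · have h3 := h ▸ h2
      rw [← q.src_eq f (by simp [h2]), ← r.src_eq f (by simp [h3])]
  obtain ⟨q, r, hq, hr, hpq, hpr, hqr⟩ := H (Sum.inl ⟨trivialPath G v, hs⟩)
  rcases q with q | q
  swap
  · exact hq
  rcases r with r | r
  swap
  · exact hr
  have hq' : q.1.rng = v := hq.symm
  have hr' : r.1.rng = v := hr.symm
  have a1 : [] ≠ q.1.edges := fun h =>
    hpq (congrArg Sum.inl (Subtype.ext (h1 (trivialPath G v) q.1 rfl hq' h)))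
  have a2 : [] ≠ r.1.edges := fun h =>
    hpr (congrArg Sum.inl (Subtype.ext (h1 (trivialPath G v) r.1 rfl hr' h)))
  have a3 : q.1.edges ≠ r.1.edges := fun h =>
    hqr (congrArg Sum.inl (Subtype.ext (h1 q.1 r.1 hq' hr' h)))
  have b2 := h0 q.1 hq'
  have b3 := h0 r.1 hr'
  grind

/-- Last edges of a finite path. -/
theorem fin_last {G : DGraph V E} (q : FinPath G) :
    q.edges = [] ∨ (∃ e, q.edges = [e] ∧ G.r e = q.rng) ∨
      ∃ L g e, q.edges = L ++ [g, e] ∧ G.r e = q.rng ∧ G.r g = G.s e := by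
  rcases List.eq_nil_or_concat q.edges with h | ⟨L, e, h⟩
  · exact Or.inl h
  rcases List.eq_nil_or_concat L with h' | ⟨L', g, h'⟩
  · subst h'
    refine Or.inr (Or.inl ⟨e, by simpa using h, by simp [FinPath.rng, h]⟩)
  · subst h'
    have h2 : q.edges = L' ++ [g, e] := by simpa using h
    refine Or.inr (Or.inr ⟨L', g, e, h2, by simp [FinPath.rng, h2], ?_⟩)
    have hc : List.IsChain (fun e f => G.r e = G.s f) q.edges := q.chain
    rw [h2] at hc
    simpa using hc.right_of_append

/-- Downward induction from the tail. -/
theorem down_all {P : ℕ → Prop} (l : ℕ) (h : ∀ n, P (l + n)) (hs : ∀ n, P (n + 1) → P n) :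
    ∀ n, P n := by
  induction l with
  | zero => intro n; simpa using h n
  | succ l ih =>
    apply ih
    intro n
    apply hs
    have := h n
    rwa [show l + 1 + n = l + n + 1 by omega] at this

theorem statement6 (G : DGraph V E) :
    (∀ p : BPath G, ∃ q r : BPath G,
      TailEquiv p q ∧ TailEquiv p r ∧ p ≠ q ∧ p ≠ r ∧ q ≠ r) ↔
    (∀ v : V, ¬ Degenerate G v) := by
  constructor
  · intro H v hd
    -- a source singular vertex has a singleton class
    have hsrc : Singular G v → recvSet G v = ∅ → False := by
      intro hs hr
      have hr' : ∀ e, G.r e ≠ v := fun e he => by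
        have : e ∈ recvSet G v := he
        rw [hr] at this; exact this
      obtain ⟨q, r, hq, hr2, hpq, hpr, hqr⟩ := H (Sum.inl ⟨trivialPath G v, hs⟩)
      rcases q with q | q
      swap
      · exact hq
      have hq' : q.1.rng = v := hq.symm
      rcases fin_last q.1 with h | ⟨e, h, h2⟩ | ⟨L, g, e, h, h2, h3⟩
      · refine hpq (congrArg Sum.inl (Subtype.ext (FinPath.eq_of ?_ h.symm)))
        simp only [FinPath.rng, h] at hq'
        exact hq'.symm
      · exact hr' e (h2.trans hq')
      · exact hr' e (h2.trans hq')
    rcases hd with ⟨e, hr, he⟩ | ⟨e, f, hef, hr, he, hrf⟩ | ⟨w, hwv, ⟨e, hr, he⟩, f, hrf, hf⟩ |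
      ⟨h, hr⟩ | ⟨hs, f, hr, hrf⟩ | ⟨hs, hr⟩
    · have hr' : ∀ g, G.r g = v → g = e := fun g hg => by
        have : g ∈ recvSet G v := hg
        rw [hr] at this; exact this
      have hre : G.r e = v := by
        have : e ∈ recvSet G v := by rw [hr]; rfl
        exact this
      have key : ∀ q : InfPath G, (∃ k l : ℕ, ∀ n, e = q.edges (l + n)) →
          ∀ n, q.edges n = e := by
        rintro q ⟨-, l, h⟩
        refine down_all l (fun n => (h n).symm) ?_
        intro n hn
        apply hr'
        rw [q.chain, hn, he]
      refine small_inf ⟨fun _ => e, fun _ => hre.trans he.symm⟩ e e ?_ ?_ H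
      · intro q hq
        exact Or.inl (key q hq 0)
      · intro q r hq hr _
        exact InfPath.eq_of fun n => (key q hq n).trans (key r hr n).symm
    · have hr' : ∀ g, G.r g = v → g = e ∨ g = f := fun g hg => by
        have : g ∈ recvSet G v := hg
        rw [hr] at this; exact this
      have hre : G.r e = v := by
        have : e ∈ recvSet G v := by rw [hr]; exact Or.inl rfl
        exact this
      have hrf' : ∀ g, G.r g ≠ G.s f := fun g hg => by
        have : g ∈ recvSet G (G.s f) := hg
        rw [hrf] at this; exact this
      have key : ∀ q : InfPath G, (∃ k l : ℕ, ∀ n, e = q.edges (l + n)) →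
          ∀ n, q.edges (n + 1) = e := by
        rintro q ⟨-, l, h⟩
        refine down_all l (fun n => (h (n + 1)).symm) ?_
        intro n hn
        rcases hr' (q.edges (n + 1)) (by rw [q.chain, hn, he]) with h | h
        · exact h
        · exact absurd (by rw [q.chain, h]) (hrf' (q.edges n))
      refine small_inf ⟨fun _ => e, fun _ => hre.trans he.symm⟩ e f ?_ ?_ H
      · intro q hq
        apply hr'
        rw [q.chain, key q hq 0, he]
      · intro q r hq hr h0
        refine InfPath.eq_of fun n => ?_
        cases n with
        | zero => exact h0
        | succ n => exact (key q hq n).trans (key r hr n).symm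
    · have hr' : ∀ g, G.r g = v → g = e := fun g hg => by
        have : g ∈ recvSet G v := hg
        rw [hr] at this; exact this
      have hre : G.r e = v := by
        have : e ∈ recvSet G v := by rw [hr]; rfl
        exact this
      have hrf' : ∀ g, G.r g = w → g = f := fun g hg => by
        have : g ∈ recvSet G w := hg
        rw [hrf] at this; exact this
      have hre' : G.r f = w := by
        have : f ∈ recvSet G w := by rw [hrf]; rfl
        exact this
      let p : InfPath G := ⟨fun n => if Even n then e else f, fun i => by
        by_cases hi : Even i
        · simp [hi, Nat.even_add_one, hre, hf]
        · simp [hi, Nat.even_add_one, hre', he]⟩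
      have hp : ∀ n, p.edges n = e ∨ p.edges n = f := by
        intro n
        by_cases hi : Even n
        · left; simp [p, hi]
        · right; simp [p, hi]
      have key : ∀ q : InfPath G, (∃ k l : ℕ, ∀ n, p.edges (k + n) = q.edges (l + n)) →
          ∀ n, q.edges n = e ∨ q.edges n = f := by
        rintro q ⟨k, l, h⟩
        refine down_all l (fun n => ?_) ?_
        · rw [← h]; exact hp _
        · rintro n (hn | hn)
          · right; apply hrf'; rw [q.chain, hn, he]
          · left; apply hr'; rw [q.chain, hn, hf]
      refine small_inf p e f (fun q hq => key q hq 0) ?_ H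
      intro q r hq hr h0
      refine InfPath.eq_of fun n => ?_
      induction n with
      | zero => exact h0
      | succ n ih =>
        have h1 := q.chain n
        have h2 := r.chain n
        rw [ih, h2] at h1
        rcases key q hq (n + 1) with a | a <;> rcases key r hr (n + 1) with b | b
        · rw [a, b]
        · rw [a, b, he, hf] at h1; exact absurd h1.symm hwv
        · rw [a, b, he, hf] at h1; exact absurd h1 hwv
        · rw [a, b]
    · exact hsrc (Or.inr h) hr
    · have hr' : ∀ g, G.r g = v → g = f := fun g hg => by
        have : g ∈ recvSet G v := hg
        rw [hr] at this; exact this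
      refine small_fin v hs f ?_ H
      intro q hq
      rcases fin_last q with h | ⟨e, h, h2⟩ | ⟨L, g, e, h, h2, h3⟩
      · exact Or.inl h
      · rw [hr' e (h2.trans hq)] at h
        exact Or.inr h
      · rw [hr' e (h2.trans hq)] at h3
        have : g ∈ recvSet G (G.s f) := h3
        rw [hrf] at this; exact this.elim
    · refine hsrc (Or.inl fun e he => ?_) hr
      have : e ∈ emitSet G v := he
      rw [hs] at this; exact this
  · intro H p
    rcases p with p | p
    · exact fin_case H p
    · exact inf_case H p
end

section
/- Let E be a directed graph with no sinks satisfying Conditions (K) and (∞). Then every tail-equivalence class of boundary paths of E is infinite; that is, for every finite boundary path μ (so r(μ) is an infinite emitter) the set of finite paths λ with r(λ) = r(μ) is infinite, and for every infinite path x the set of infinite paths tail-equivalent to x is infinite. -/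
variable {V E : Type*}

section
variable {G : DGraph V E}

theorem aux_rng_cons (l : List E) (e : E) (v : V) :
    (e :: l).getLast?.elim v G.r = l.getLast?.elim (G.r e) G.r := by
  cases l with
  | nil => simp
  | cons a t => simp [List.getLast?_cons_cons, List.getLast?_cons]

/-- Prepend an edge to a finite path. -/
def auxCons (e : E) (μ : FinPath G) (h : μ.src = G.r e) : FinPath G where
  src := G.s e
  edges := e :: μ.edges
  src_eq := by intro f hf; simp at hf; rw [hf]
  chain := by
    refine List.isChain_cons.2 ⟨?_, μ.chain⟩
    intro f hf
    rw [μ.src_eq f hf, h]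

theorem auxCons_rng (e : E) (μ : FinPath G) (h : μ.src = G.r e) :
    (auxCons e μ h).rng = μ.rng := by
  simp only [FinPath.rng, auxCons]
  rw [aux_rng_cons, h]

theorem aux_finite (hInf : CondInf G) (v : V) (hv : InfEmitter G v)
    (p : {μ : FinPath G // Singular G μ.rng}) (hp : p.1.rng = v) :
    {q : BPath G | TailEquiv (Sum.inl p) q}.Infinite := by
  have hT := hInf v hv
  have : Infinite {e : E | G.s e = v ∧ Reaches G (G.r e) v} := hT.to_subtype
  choose μ h1 h2 using fun e : {e : E | G.s e = v ∧ Reaches G (G.r e) v} => e.2.2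
  have h3 : ∀ e, (auxCons e.1 (μ e) (h1 e)).rng = v := fun e => by rw [auxCons_rng, h2]
  refine Set.infinite_of_injective_forall_mem
    (f := fun e => (Sum.inl ⟨auxCons e.1 (μ e) (h1 e), by rw [h3]; exact Or.inr hv⟩ : BPath G))
    ?_ ?_
  · intro e f hef
    have h4 := congrArg (fun p => (FinPath.edges (Subtype.val p))) (Sum.inl.inj hef)
    simp only [auxCons] at h4
    exact Subtype.ext (List.cons.inj h4).1
  · intro e
    change p.1.rng = (auxCons e.1 (μ e) (h1 e)).rng
    rw [h3, hp]

theorem aux_ext {x y : InfPath G} (h : ∀ n, x.edges n = y.edges n) : x = y := by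
  cases x; cases y; congr; exact funext h

theorem aux_rng_get (μ : FinPath G) (h : μ.edges ≠ []) (n : ℕ) (hn : n + 1 = μ.edges.length) :
    μ.rng = G.r (μ.edges[n]'(by omega)) := by
  have h2 : μ.edges.length - 1 = n := by omega
  simp [FinPath.rng, List.getLast?_eq_getElem?, h2, List.getElem?_eq_getElem (show n < μ.edges.length by omega)]

/-- Prepend a cycle to an infinite path. -/
def auxPre (μ : FinPath G) (z : InfPath G) (hμ : μ.edges ≠ []) (h : μ.rng = z.src) :
    InfPath G where
  edges n := μ.edges.getD n (z.edges (n - μ.edges.length))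
  chain i := by
    rcases lt_trichotomy (i + 1) μ.edges.length with h1 | h1 | h1
    · have := List.isChain_iff_getElem.1 μ.chain i h1
      rw [List.getD_eq_getElem _ _ h1, List.getD_eq_getElem _ _ (Nat.lt_of_succ_lt h1)]
      exact this
    · have h2 : i < μ.edges.length := by omega
      rw [List.getD_eq_getElem _ _ h2, List.getD_eq_default _ _ h1.ge, ← aux_rng_get μ hμ i h1,
        h, h1]
      simp [InfPath.src]
    · rw [List.getD_eq_default _ _ (by omega), List.getD_eq_default _ _ (by omega), z.chain]
      congr 2; omega

theorem auxPre_src (μ : FinPath G) (z : InfPath G) (hμ : μ.edges ≠ []) (h : μ.rng = z.src) :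
    (auxPre μ z hμ h).src = μ.src := by
  have h0 : 0 < μ.edges.length := List.length_pos_iff.2 hμ
  simp only [InfPath.src, auxPre]
  rw [List.getD_eq_getElem _ _ h0]
  apply μ.src_eq
  simp [List.head?_eq_getElem?]

theorem auxPre_lt (μ : FinPath G) (z : InfPath G) (hμ : μ.edges ≠ []) (h : μ.rng = z.src)
    (n : ℕ) (hn : n < μ.edges.length) : (auxPre μ z hμ h).edges n = μ.edges[n] := by
  simp only [auxPre]
  rw [List.getD_eq_getElem _ _ hn]

theorem auxPre_ge (μ : FinPath G) (z : InfPath G) (hμ : μ.edges ≠ []) (h : μ.rng = z.src)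
    (n : ℕ) : (auxPre μ z hμ h).edges (μ.edges.length + n) = z.edges n := by
  simp only [auxPre]
  rw [List.getD_eq_default _ _ (by omega)]
  congr 1; omega

theorem aux_not_lt {α β : FinPath G} {w : V} (ha : α.IsReturnPath) (hb : β.IsReturnPath)
    (hαw : α.src = w) (hβw : β.src = w) (z z' : InfPath G)
    (h : α.rng = z.src) (h' : β.rng = z'.src)
    (he : auxPre α z ha.1.1 h = auxPre β z' hb.1.1 h') :
    β.edges.length ≤ α.edges.length := by
  by_contra! hlt
  have hpos : 0 < α.edges.length := List.length_pos_iff.2 ha.1.1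
  obtain ⟨n, hn⟩ : ∃ n, n + 1 = α.edges.length := ⟨α.edges.length - 1, by omega⟩
  have h1 := aux_rng_get α ha.1.1 n hn
  have h2 := auxPre_lt α z ha.1.1 h n (by omega)
  have h3 := auxPre_lt β z' hb.1.1 h' n (by omega)
  rw [he, h3] at h2
  apply hb.2 n (by omega)
  rw [hb.1.2, List.get_eq_getElem, h2, ← h1, ha.1.2, hαw, hβw]

theorem aux_disj {α β : FinPath G} {w : V} (ha : α.IsReturnPath) (hb : β.IsReturnPath)
    (hαw : α.src = w) (hβw : β.src = w) (z z' : InfPath G)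
    (h : α.rng = z.src) (h' : β.rng = z'.src)
    (he : auxPre α z ha.1.1 h = auxPre β z' hb.1.1 h') : α = β := by
  have l1 := aux_not_lt ha hb hαw hβw z z' h h' he
  have l2 := aux_not_lt hb ha hβw hαw z' z h' h he.symm
  have hE : α.edges = β.edges := by
    refine List.ext_getElem (by omega) fun n hn hn' => ?_
    rw [← auxPre_lt α z ha.1.1 h n hn, ← auxPre_lt β z' hb.1.1 h' n hn', he]
  cases α; cases β
  simp only at hE hαw hβw
  subst hE hαw hβw
  rfl

theorem auxPre_tail (x : InfPath G) (μ : FinPath G) (z : InfPath G) (hμ : μ.edges ≠ [])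
    (h : μ.rng = z.src) (ht : ∃ k l : ℕ, ∀ n : ℕ, x.edges (k + n) = z.edges (l + n)) :
    ∃ k l : ℕ, ∀ n : ℕ, x.edges (k + n) = (auxPre μ z hμ h).edges (l + n) := by
  obtain ⟨k, l, hkl⟩ := ht
  refine ⟨k, μ.edges.length + l, fun n => ?_⟩
  rw [hkl, add_assoc, auxPre_ge]

/-- The shift of an infinite path. -/
def auxShift (x : InfPath G) (m : ℕ) : InfPath G where
  edges n := x.edges (m + n)
  chain i := x.chain (m + i)

theorem aux_exists_return (y : InfPath G) (hk : ∃ k, 0 < k ∧ G.s (y.edges k) = y.src) :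
    ∃ μ : FinPath G, μ.IsReturnPath ∧ μ.src = y.src := by
  classical
  obtain ⟨hpos, hk1⟩ := Nat.find_spec hk
  have hmin := fun m (hm : m < Nat.find hk) => Nat.find_min hk hm
  generalize Nat.find hk = k at *
  let μ : FinPath G :=
    { src := y.src
      edges := (List.range k).map y.edges
      src_eq := by
        intro e he
        obtain ⟨j, rfl⟩ : ∃ j, k = j + 1 := ⟨k - 1, by omega⟩
        simp [List.range_succ_eq_map] at he
        rw [← he]; rfl
      chain := by
        refine List.isChain_iff_getElem.2 fun i hi => ?_
        simp [y.chain] }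
  have hlen : μ.edges.length = k := by simp [μ]
  have hne : μ.edges ≠ [] := by
    intro h; rw [h] at hlen; simp at hlen; omega
  have hr : μ.rng = y.src := by
    obtain ⟨j, rfl⟩ : ∃ j, k = j + 1 := ⟨k - 1, by omega⟩
    rw [aux_rng_get μ hne j hlen.symm]
    simp [μ, y.chain, hk1]
  refine ⟨μ, ⟨⟨hne, hr⟩, fun i hi => ?_⟩, rfl⟩
  rw [hr]
  intro hcon
  refine hmin (i + 1) (by omega) ⟨by omega, ?_⟩
  rw [← hcon, ← y.chain]
  simp [μ]

theorem aux_infinite (hK : CondK G) (x : InfPath G) :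
    {y : InfPath G | ∃ k l : ℕ, ∀ n : ℕ, x.edges (k + n) = y.edges (l + n)}.Infinite := by
  by_cases hinj : Function.Injective (auxShift x)
  · refine Set.infinite_of_injective_forall_mem hinj fun m => ⟨m, 0, fun n => ?_⟩
    simp [auxShift]
  · obtain ⟨m, n, hmn, hlt⟩ : ∃ m n, auxShift x m = auxShift x n ∧ m < n := by
      simp only [Function.Injective, not_forall] at hinj
      obtain ⟨a, b, hab, hne⟩ := hinj
      rcases lt_or_gt_of_ne hne with h | h
      · exact ⟨a, b, hab, h⟩
      · exact ⟨b, a, hab.symm, h⟩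
    have hret := aux_exists_return (auxShift x m) ⟨n - m, by omega, by
      have := congrArg InfPath.src hmn
      rw [this]
      simp only [InfPath.src, auxShift]
      congr 2; omega⟩
    rcases hK (auxShift x m).src with h | ⟨α, β, hne, ha, hb, haw, hbw⟩
    · exact absurd hret h
    intro hfin
    set w := (auxShift x m).src
    let S : Set (InfPath G) := {y | (∃ k l : ℕ, ∀ n : ℕ, x.edges (k + n) = y.edges (l + n)) ∧
      y.src = w}
    have hS : S.Finite := hfin.subset fun y hy => hy.1
    have : Finite S := hS
    let z0 : S := ⟨auxShift x m, ⟨m, 0, fun n => by simp [auxShift]⟩, rfl⟩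
    have hA : ∀ z : S, α.rng = z.1.src := fun z => by rw [ha.1.2, haw, z.2.2]
    have hB : ∀ z : S, β.rng = z.1.src := fun z => by rw [hb.1.2, hbw, z.2.2]
    let A : S → S := fun z => ⟨auxPre α z.1 ha.1.1 (hA z), auxPre_tail x _ _ _ _ z.2.1, by
      rw [auxPre_src, haw]⟩
    have hAinj : Function.Injective A := by
      intro z z' h
      have h := congrArg Subtype.val h
      refine Subtype.ext (aux_ext fun n => ?_)
      rw [← auxPre_ge α z.1 ha.1.1 (hA z) n, ← auxPre_ge α z'.1 ha.1.1 (hA z') n]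
      exact congrArg (fun y : InfPath G => y.edges (α.edges.length + n)) h
    obtain ⟨z, hz⟩ := Finite.surjective_of_injective hAinj
      ⟨auxPre β z0.1 hb.1.1 (hB z0), auxPre_tail x _ _ _ _ z0.2.1, by rw [auxPre_src, hbw]⟩
    exact hne (aux_disj ha hb haw hbw z.1 z0.1 (hA z) (hB z0) (congrArg Subtype.val hz))

end

/-- If `E` has no sinks and satisfies Conditions (K) and (∞), then every
tail-equivalence class of boundary paths of `E` is infinite. -/
theorem statement8 (G : DGraph V E) (hs : ∀ v : V, ¬ IsSink G v)
    (hK : CondK G) (hInf : CondInf G) :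
    ∀ p : BPath G, {q : BPath G | TailEquiv p q}.Infinite := by
  rintro (p | x)
  · exact aux_finite hInf p.1.rng (p.2.resolve_left (hs _)) p rfl
  · refine ((aux_infinite hK x).image (f := (Sum.inr : InfPath G → BPath G))
      Sum.inr_injective.injOn).mono ?_
    rintro _ ⟨y, hy, rfl⟩
    exact hy
end

section
/- Let E be a directed graph satisfying Condition (K) and let μ be a cycle in E. Then there exist infinitely many cycles λ₁, λ₂, … based at s(μ) such that the paths μ, λ₁, λ₂, … are mutually disjoint; that is, there is an injective sequence of cycles based at s(μ), pairwise disjoint from each other and each disjoint from μ. -/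
variable {V E : Type*}

/-- `repApp n m k` is the list `n ++ n ++ ⋯ ++ n ++ m` with `k` copies of `n`. -/
def repApp {α : Type*} (n m : List α) : ℕ → List α
  | 0 => m
  | k + 1 => n ++ repApp n m k

theorem repApp_incomp {α : Type*} (n m : List α) (h1 : ¬ n <+: m) (h2 : ¬ m <+: n) :
    ∀ i j : ℕ, i ≠ j → ¬ repApp n m i <+: repApp n m j
  | 0, 0, h => absurd rfl h
  | 0, j + 1, _ => fun h => by
      rcases List.prefix_or_prefix_of_prefix h (List.prefix_append n (repApp n m j)) with h | h
      · exact h2 h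
      · exact h1 h
  | i + 1, 0, _ => fun h => h1 ((List.prefix_append n (repApp n m i)).trans h)
  | i + 1, j + 1, h => fun h' =>
      repApp_incomp n m h1 h2 i j (by omega) ((List.prefix_append_right_inj n).1 h')

theorem FinPath.ext' {V E : Type*} {G : DGraph V E} {p q : FinPath G} (h : p.src = q.src)
    (h' : p.edges = q.edges) : p = q := by
  cases p; cases q; cases h; cases h'; rfl

theorem FinPath.exists_append {V E : Type*} {G : DGraph V E} (p q : FinPath G)
    (hp : p.IsCycle) (hq : q.IsCycle) (h : p.src = q.src) :
    ∃ t : FinPath G, t.IsCycle ∧ t.src = q.src ∧ t.edges = p.edges ++ q.edges := by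
  obtain ⟨hp1, hp2⟩ := hp
  obtain ⟨hq1, hq2⟩ := hq
  have hp3 := p.src_eq
  have hq3 := q.src_eq
  unfold FinPath.rng at hp2 hq2
  refine ⟨⟨q.src, p.edges ++ q.edges, ?_, ?_⟩, ⟨?_, ?_⟩, rfl, rfl⟩
  · intro e he
    rw [← h]
    apply p.src_eq
    rwa [List.head?_append_of_ne_nil _ hp1] at he
  · refine List.isChain_append.2 ⟨p.chain, q.chain, ?_⟩
    intro x hx y hy
    rw [q.src_eq y hy, ← h, ← hp2]
    rw [Option.mem_def] at hx
    rw [hx]; rfl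
  · simp [hp1]
  · unfold FinPath.rng
    simp only [List.getLast?_append_of_ne_nil _ hq1]
    exact hq2

/-- A cycle which is an initial segment of a return path with the same base is all of it. -/
theorem FinPath.IsReturnPath.eq_of_prefix {V E : Type*} {G : DGraph V E} {p q : FinPath G}
    (hp : p.IsReturnPath) (hq : q.IsCycle) (h : q.src = p.src) (hpre : q.edges <+: p.edges) :
    q = p := by
  refine FinPath.ext' h (hpre.eq_of_length_le ?_)
  by_contra hlt
  push Not at hlt
  obtain ⟨hq1, hq2⟩ := hq
  have hpos := List.length_pos_iff.2 hq1
  refine hp.2 (q.edges.length - 1) (by omega) ?_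
  rw [hp.1.2, ← h, ← hq2, FinPath.rng, List.getLast?_eq_getElem?,
    List.getElem?_eq_getElem (by omega)]
  simp [hpre.getElem]

theorem FinPath.exists_returnPath {V E : Type*} {G : DGraph V E} (n : ℕ) :
    ∀ p : FinPath G, p.edges.length = n → p.IsCycle →
      ∃ q : FinPath G, q.IsReturnPath ∧ q.src = p.src := by
  induction n using Nat.strong_induction_on with
  | _ n ih =>
    intro p hn hp
    by_cases hr : p.IsReturnPath
    · exact ⟨p, hr, rfl⟩
    · have : ∃ (i : ℕ) (h : i + 1 < p.edges.length),
          G.r (p.edges.get ⟨i, Nat.lt_of_succ_lt h⟩) = p.rng := by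
        by_contra hcon
        push Not at hcon
        exact hr ⟨hp, hcon⟩
      obtain ⟨i, hi, he⟩ := this
      obtain ⟨q, hq, hqs⟩ := ih (i + 1) (by omega)
        ⟨p.src, p.edges.take (i + 1), by
          intro e he
          apply p.src_eq
          simpa [List.head?_take] using he, p.chain.take _⟩
        (by simp; omega)
        ⟨by simp [hp.1], by
          refine Eq.trans ?_ (he.trans hp.2)
          simp [FinPath.rng, List.getLast?_eq_getElem?, List.getElem?_take, Nat.min_eq_left hi.le,
            List.getElem?_eq_getElem (Nat.lt_of_succ_lt hi)]⟩
      exact ⟨q, hq, hqs⟩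

/-- If `E` satisfies Condition (K) and `μ` is a cycle in `E`, then there is
an injective sequence of cycles based at `s(μ)`, pairwise disjoint and each disjoint
from `μ`. -/
theorem statement9 (G : DGraph V E) (hK : CondK G)
    (μ : FinPath G) (hμ : μ.IsCycle) :
    ∃ lam : ℕ → FinPath G, Function.Injective lam ∧
      (∀ n : ℕ, (lam n).IsCycle ∧ (lam n).src = μ.src) ∧
      (∀ m n : ℕ, m ≠ n → (lam m).Disjoint (lam n)) ∧
      (∀ n : ℕ, μ.Disjoint (lam n)) := by
  have hν : ∃ ν : FinPath G, ν.IsCycle ∧ ν.src = μ.src ∧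
      ¬ ν.edges <+: μ.edges ∧ ¬ μ.edges <+: ν.edges := by
    rcases hK μ.src with h | ⟨a, b, hab, ha, hb, has, hbs⟩
    · exact absurd (FinPath.exists_returnPath _ μ rfl hμ) h
    · have hab1 : ¬ a.edges <+: b.edges := fun h =>
        hab (hb.eq_of_prefix ha.1 (has.trans hbs.symm) h)
      have hab2 : ¬ b.edges <+: a.edges := fun h =>
        hab (ha.eq_of_prefix hb.1 (hbs.trans has.symm) h).symm
      by_contra hcon
      push Not at hcon
      have key : ∀ c : FinPath G, c.IsReturnPath → c.src = μ.src → c.edges <+: μ.edges := by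
        intro c hc hcs
        by_contra h
        have := hc.eq_of_prefix hμ hcs.symm (hcon c hc.1 hcs h)
        exact h (this ▸ List.prefix_rfl)
      rcases List.prefix_or_prefix_of_prefix (key a ha has) (key b hb hbs) with h | h
      · exact hab1 h
      · exact hab2 h
  obtain ⟨ν, hνc, hνs, h1, h2⟩ := hν
  have hex : ∀ k : ℕ, ∃ p : FinPath G, p.IsCycle ∧ p.src = μ.src ∧
      p.edges = repApp ν.edges μ.edges k := by
    intro k
    induction k with
    | zero => exact ⟨μ, hμ, rfl, rfl⟩
    | succ k ih =>
      obtain ⟨p, hp, hps, hpe⟩ := ih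
      obtain ⟨t, ht, hts, hte⟩ := FinPath.exists_append ν p hνc hp (hνs.trans hps.symm)
      exact ⟨t, ht, hts.trans hps, by rw [hte, hpe]; rfl⟩
  choose f hfc hfs hfe using hex
  have inc := repApp_incomp ν.edges μ.edges h1 h2
  have hd : ∀ m n : ℕ, m ≠ n → (f (m + 1)).Disjoint (f (n + 1)) := by
    intro m n hmn
    refine ⟨fun h => inc (m + 1) (n + 1) (by omega) ?_,
      fun h => inc (n + 1) (m + 1) (by omega) ?_⟩
    · rw [← hfe, ← hfe]; exact h.2
    · rw [← hfe, ← hfe]; exact h.2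
  refine ⟨fun k => f (k + 1), ?_, fun n => ⟨hfc _, hfs _⟩, hd, ?_⟩
  · intro m n hmn
    by_contra hne
    refine (hd m n hne).1 ?_
    have hmn' : f (m + 1) = f (n + 1) := hmn
    rw [hmn']
    exact ⟨rfl, List.prefix_rfl⟩
  · intro n
    refine ⟨fun h => inc 0 (n + 1) (by omega) ?_, fun h => inc (n + 1) 0 (by omega) ?_⟩
    · rw [← hfe (n + 1)]; exact h.2
    · rw [← hfe (n + 1)]; exact h.2
end
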